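/- arXiv:2312.09769 — 4 statements merged into one kernel-verified Lean document; each statement's English description precedes it below -/
import Mathlib

section
/- Maximum entropy principle for the Gibbs measure (Proposition 4.2 of the paper): Let μ = λ.withDensity φ be a probability measure on P with measurable density φ ≥ 0 such that φ·log φ is λ-integrable, H₀ is integrable with respect to both μ and ℙ∞, and ∫_P H₀ dμ = ∫_P H₀ dℙ∞. Then H(μ ∥ λ) ≥ H(ℙ∞ ∥ λ); that is, among all probability measures absolutely continuous with respect to λ having the same average energy as the Gibbs measure, the Gibbs measure ℙ∞ has maximal entropy (minimal relative entropy with respect to λ). -/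
open MeasureTheory Real

theorem gibbs_aux {P : Type*} [MeasurableSpace P] (lam : Measure P) (ρ : P → ℝ)
    (hm : Measurable ρ) (h0 : ∀ x, 0 ≤ ρ x) (g : P → ℝ)
    (hg : Integrable g (lam.withDensity (fun x => ENNReal.ofReal (ρ x)))) :
    Integrable (fun x => ρ x * g x) lam ∧
      ∫ x, g x ∂(lam.withDensity (fun x => ENNReal.ofReal (ρ x))) = ∫ x, ρ x * g x ∂lam := by
  have hfin : ∀ᵐ x ∂lam, ENNReal.ofReal (ρ x) < ⊤ := by simp
  constructor
  · rw [integrable_withDensity_iff hm.ennreal_ofReal hfin] at hg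
    refine hg.congr (Filter.Eventually.of_forall fun x => ?_)
    simp only [ENNReal.toReal_ofReal (h0 x), mul_comm]
  · rw [integral_withDensity_eq_integral_toReal_smul hm.ennreal_ofReal hfin]
    simp only [ENNReal.toReal_ofReal (h0 _), smul_eq_mul]

/-- **Maximum entropy principle for the Gibbs measure** (Proposition 4.2).
Among all probability measures `μ = λ.withDensity φ` absolutely continuous with
respect to `λ` having the same average energy as the Gibbs measure
`ℙ∞ = λ.withDensity ψ`, `ψ = Z⁻¹ exp (-β H₀)`, the Gibbs measure has maximal
entropy, i.e. minimal relative entropy `H(· ∥ λ) = ∫ ρ log ρ dλ`. -/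
theorem gibbs_measure_max_entropy
    {P : Type*} [MeasurableSpace P] (lam : Measure P) [SigmaFinite lam] (hlam : lam ≠ 0)
    (H0 : P → ℝ) (hH0meas : Measurable H0) (β : ℝ) (hβ : 0 < β)
    (hZint : Integrable (fun x => Real.exp (-β * H0 x)) lam)
    (Z : ℝ) (hZ : Z = ∫ x, Real.exp (-β * H0 x) ∂lam)
    (ψ : P → ℝ) (hψ : ψ = fun x => Z⁻¹ * Real.exp (-β * H0 x))
    (Pinf : Measure P) (hPinf : Pinf = lam.withDensity (fun x => ENNReal.ofReal (ψ x)))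
    (φ : P → ℝ) (hφmeas : Measurable φ) (hφnonneg : ∀ x, 0 ≤ φ x)
    (μ : Measure P) (hμ : μ = lam.withDensity (fun x => ENNReal.ofReal (φ x)))
    (hμprob : IsProbabilityMeasure μ)
    (hφlog : Integrable (fun x => φ x * Real.log (φ x)) lam)
    (hH0μ : Integrable H0 μ) (hH0Pinf : Integrable H0 Pinf)
    (henergy : ∫ x, H0 x ∂μ = ∫ x, H0 x ∂Pinf) :
    ∫ x, ψ x * Real.log (ψ x) ∂lam ≤ ∫ x, φ x * Real.log (φ x) ∂lam := by
  have hZpos : 0 < Z := by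
    rw [hZ]
    have : NeZero lam := ⟨hlam⟩
    exact integral_exp_pos hZint
  have hψpos : ∀ x, 0 < ψ x := fun x => by rw [hψ]; positivity
  have hψmeas : Measurable ψ := by rw [hψ]; fun_prop
  have hψint : Integrable ψ lam := by rw [hψ]; exact hZint.const_mul _
  have hψ1 : ∫ x, ψ x ∂lam = 1 := by
    rw [hψ, integral_const_mul, ← hZ]
    exact inv_mul_cancel₀ hZpos.ne'
  have hlogψ : ∀ x, Real.log (ψ x) = -Real.log Z - β * H0 x := fun x => by
    rw [hψ]
    simp only
    rw [Real.log_mul (inv_ne_zero hZpos.ne') (Real.exp_ne_zero _), Real.log_inv, Real.log_exp]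
    ring
  subst hμ hPinf
  obtain ⟨iφH, eφH⟩ := gibbs_aux lam φ hφmeas hφnonneg H0 hH0μ
  obtain ⟨iψH, eψH⟩ := gibbs_aux lam ψ hψmeas (fun x => (hψpos x).le) H0 hH0Pinf
  obtain ⟨iφ, eφ⟩ := gibbs_aux lam φ hφmeas hφnonneg (fun _ => 1) (integrable_const _)
  simp only [mul_one] at iφ eφ
  have hφ1 : ∫ x, φ x ∂lam = 1 := by rw [← eφ]; simp
  have e1 : ∫ x, ψ x * Real.log (ψ x) ∂lam = -Real.log Z - β * ∫ x, ψ x * H0 x ∂lam := by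
    calc ∫ x, ψ x * Real.log (ψ x) ∂lam
        = ∫ x, (-Real.log Z * ψ x - β * (ψ x * H0 x)) ∂lam := by
          congr 1; ext x; rw [hlogψ]; ring
      _ = _ := by
          rw [integral_sub (hψint.const_mul _) (iψH.const_mul _), integral_const_mul,
            integral_const_mul, hψ1, mul_one]
  have i1 : Integrable (fun x => -Real.log Z * φ x - β * (φ x * H0 x)) lam :=
    (iφ.const_mul _).sub (iφH.const_mul _)
  have i2 : Integrable (fun x => φ x - ψ x) lam := iφ.sub hψint
  have e2 : ∫ x, ((-Real.log Z * φ x - β * (φ x * H0 x)) + (φ x - ψ x)) ∂lam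
      = -Real.log Z - β * ∫ x, φ x * H0 x ∂lam := by
    rw [integral_add i1 i2, integral_sub (iφ.const_mul _) (iφH.const_mul _),
      integral_sub iφ hψint, integral_const_mul, integral_const_mul, hφ1, hψ1]
    ring
  rw [e1, ← eψH, ← henergy, eφH, ← e2]
  refine integral_mono (i1.add i2) hφlog fun x => ?_
  have key : φ x * Real.log (ψ x) + (φ x - ψ x) ≤ φ x * Real.log (φ x) := by
    rcases (hφnonneg x).eq_or_lt with h | h
    · rw [← h]; simp [(hψpos x).le]
    · have h1 := Real.log_le_sub_one_of_pos (div_pos (hψpos x) h)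
      rw [Real.log_div (hψpos x).ne' h.ne'] at h1
      have h2 := mul_le_mul_of_nonneg_left h1 h.le
      have h3 : φ x * (ψ x / φ x - 1) = ψ x - φ x := by field_simp
      rw [h3] at h2
      linarith
  rw [hlogψ] at key
  simp only
  linarith
end

section
/- Uniqueness of the entropy maximizer: under the above hypotheses (μ = λ.withDensity φ a probability measure, φ·log φ λ-integrable, H₀ integrable with respect to both μ and ℙ∞, and ∫_P H₀ dμ = ∫_P H₀ dℙ∞), if in addition H(μ ∥ λ) = H(ℙ∞ ∥ λ), then φ = ψ λ-almost everywhere, i.e. μ = ℙ∞. Hence the Gibbs measure is the unique maximizer of entropy subject to the average-energy constraint. -/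
open MeasureTheory Real

theorem gibbs_aux_pos {a b : ℝ} (ha : 0 ≤ a) (hb : 0 < b) (hab : a ≠ b) :
    0 < a * Real.log a - a * Real.log b - a + b := by
  rcases ha.eq_or_lt with h | h
  · subst h; simpa using hb
  · have h1 : b / a ≠ 1 := by
      intro h2
      rw [div_eq_one_iff_eq h.ne'] at h2
      exact hab h2.symm
    have h2 := Real.log_lt_sub_one_of_pos (div_pos hb h) h1
    rw [Real.log_div hb.ne' h.ne'] at h2
    have h3 := mul_lt_mul_of_pos_left h2 h
    have h4 : a * (b / a - 1) = b - a := by field_simp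
    rw [h4] at h3
    linarith [mul_sub a (Real.log b) (Real.log a)]

theorem gibbs_aux_density {P : Type*} [MeasurableSpace P] (lam : Measure P)
    (f H : P → ℝ) (hf : Measurable f) (hf0 : ∀ x, 0 ≤ f x)
    (hH : Integrable H (lam.withDensity (fun x => ENNReal.ofReal (f x)))) :
    Integrable (fun x => f x * H x) lam ∧
      ∫ x, H x ∂(lam.withDensity (fun x => ENNReal.ofReal (f x))) = ∫ x, f x * H x ∂lam := by
  constructor
  · rw [integrable_withDensity_iff hf.ennreal_ofReal (by simp)] at hH
    refine hH.congr (Filter.Eventually.of_forall fun x => ?_)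
    simp [ENNReal.toReal_ofReal (hf0 x), mul_comm]
  · rw [integral_withDensity_eq_integral_toReal_smul hf.ennreal_ofReal (by simp)]
    refine integral_congr_ae (Filter.Eventually.of_forall fun x => ?_)
    simp [ENNReal.toReal_ofReal (hf0 x)]

/-- **Uniqueness of the entropy maximizer**: if moreover `H(μ ∥ λ) = H(ℙ∞ ∥ λ)`,
then `φ = ψ` λ-almost everywhere, i.e. `μ = ℙ∞`; hence the Gibbs measure is the
unique maximizer of entropy subject to the average-energy constraint. -/
theorem gibbs_measure_unique_max_entropy
    {P : Type*} [MeasurableSpace P] (lam : Measure P) [SigmaFinite lam] (hlam : lam ≠ 0)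
    (H0 : P → ℝ) (hH0meas : Measurable H0) (β : ℝ) (hβ : 0 < β)
    (hZint : Integrable (fun x => Real.exp (-β * H0 x)) lam)
    (Z : ℝ) (hZ : Z = ∫ x, Real.exp (-β * H0 x) ∂lam)
    (ψ : P → ℝ) (hψ : ψ = fun x => Z⁻¹ * Real.exp (-β * H0 x))
    (Pinf : Measure P) (hPinf : Pinf = lam.withDensity (fun x => ENNReal.ofReal (ψ x)))
    (φ : P → ℝ) (hφmeas : Measurable φ) (hφnonneg : ∀ x, 0 ≤ φ x)
    (μ : Measure P) (hμ : μ = lam.withDensity (fun x => ENNReal.ofReal (φ x)))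
    (hμprob : IsProbabilityMeasure μ)
    (hφlog : Integrable (fun x => φ x * Real.log (φ x)) lam)
    (hH0μ : Integrable H0 μ) (hH0Pinf : Integrable H0 Pinf)
    (henergy : ∫ x, H0 x ∂μ = ∫ x, H0 x ∂Pinf)
    (hentropy : ∫ x, φ x * Real.log (φ x) ∂lam = ∫ x, ψ x * Real.log (ψ x) ∂lam) :
    (∀ᵐ x ∂lam, φ x = ψ x) ∧ μ = Pinf := by
  have hZpos : 0 < Z := by
    rw [hZ]
    have : NeZero lam := ⟨hlam⟩
    exact integral_exp_pos hZint
  have hψpos : ∀ x, 0 < ψ x := fun x => by rw [hψ]; positivity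
  have hψmeas : Measurable ψ := by rw [hψ]; fun_prop
  have hψint : Integrable ψ lam := by rw [hψ]; exact hZint.const_mul _
  have hψone : ∫ x, ψ x ∂lam = 1 := by
    rw [hψ, integral_const_mul, ← hZ]
    exact inv_mul_cancel₀ hZpos.ne'
  have hψlog : ∀ x, Real.log (ψ x) = -Real.log Z - β * H0 x := fun x => by
    rw [hψ]
    simp only
    rw [Real.log_mul (inv_ne_zero hZpos.ne') (Real.exp_ne_zero _), Real.log_inv, Real.log_exp]
    ring
  rw [hμ] at hH0μ henergy
  rw [hPinf] at hH0Pinf henergy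
  obtain ⟨hφH, hφH'⟩ := gibbs_aux_density lam φ H0 hφmeas hφnonneg hH0μ
  obtain ⟨hψH, hψH'⟩ := gibbs_aux_density lam ψ H0 hψmeas (fun x => (hψpos x).le) hH0Pinf
  rw [hφH', hψH'] at henergy
  have hφ1 : Integrable (fun _ => (1 : ℝ)) (lam.withDensity (fun x => ENNReal.ofReal (φ x))) := by
    rw [← hμ]; exact integrable_const _
  obtain ⟨hφint, hφone⟩ := gibbs_aux_density lam φ (fun _ => 1) hφmeas hφnonneg hφ1
  rw [← hμ] at hφone
  simp only [mul_one, integral_const, probReal_univ, smul_eq_mul] at hφint hφone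
  have hcross : ∀ f : P → ℝ, (fun x => f x * Real.log (ψ x)) =
      fun x => (-Real.log Z) * f x - β * (f x * H0 x) := fun f => by
    funext x; rw [hψlog]; ring
  have hφψ : Integrable (fun x => φ x * Real.log (ψ x)) lam := by
    rw [hcross]; exact (hφint.const_mul _).sub (hφH.const_mul _)
  have hcrosseq : ∫ x, φ x * Real.log (ψ x) ∂lam = ∫ x, ψ x * Real.log (ψ x) ∂lam := by
    rw [hcross φ, hcross ψ, integral_sub (hφint.const_mul _) (hφH.const_mul _),
      integral_sub (hψint.const_mul _) (hψH.const_mul _)]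
    simp only [integral_const_mul]
    rw [henergy, hψone, ← hφone]
  have hgint : Integrable
      (fun x => φ x * Real.log (φ x) - φ x * Real.log (ψ x) - φ x + ψ x) lam :=
    ((hφlog.sub hφψ).sub hφint).add hψint
  have hg : ∫ x, (φ x * Real.log (φ x) - φ x * Real.log (ψ x) - φ x + ψ x) ∂lam = 0 := by
    have i1 : Integrable (fun x => φ x * Real.log (φ x) - φ x * Real.log (ψ x)) lam :=
      hφlog.sub hφψ
    have i2 : Integrable (fun x => φ x * Real.log (φ x) - φ x * Real.log (ψ x) - φ x) lam :=
      i1.sub hφint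
    rw [integral_add i2 hψint, integral_sub i1 hφint, integral_sub hφlog hφψ]
    linarith
  have hnn : ∀ x, 0 ≤ φ x * Real.log (φ x) - φ x * Real.log (ψ x) - φ x + ψ x := fun x => by
    by_cases h : φ x = ψ x
    · rw [h]; linarith
    · exact (gibbs_aux_pos (hφnonneg x) (hψpos x) h).le
  rw [integral_eq_zero_iff_of_nonneg hnn hgint] at hg
  have hae : ∀ᵐ x ∂lam, φ x = ψ x := by
    filter_upwards [hg] with x hx
    by_contra h
    exact (gibbs_aux_pos (hφnonneg x) (hψpos x) h).ne' hx
  refine ⟨hae, ?_⟩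
  rw [hμ, hPinf]
  apply withDensity_congr_ae
  filter_upwards [hae] with x hx
  rw [hx]
end

section
/- Energy dissipation along the deterministic part of the Lie–Poisson–Langevin system (zero-noise limit of equation (4.22)): Let h : 𝔤* → ℝ be differentiable with gradient representative δh : 𝔤* → 𝔤, let θ ≥ 0, and let μ : ℝ → 𝔤* be a differentiable curve such that, setting u(t) := δh(μ(t)) and a(t) := ♯(ad*_{u(t)} μ(t)), one has μ'(t) = ad*_{u(t)} μ(t) + θ·ad*_{a(t)} μ(t) for all t. Then (h ∘ μ)'(t) = −θ·γ(a(t), a(t)) for all t; in particular t ↦ h(μ(t)) is nonincreasing. -/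
open scoped RealInnerProductSpace

/-- **Energy dissipation along the deterministic part of the Lie–Poisson–Langevin
system** (zero-noise limit of equation (4.22)): on a finite-dimensional real Lie
algebra `𝔤` (given here as an inner product space `G` whose Lie bracket is the
bilinear map `bkt`, with `ad*` the coadjoint action and `♯` the musical isomorphism
of the inner product `γ = ⟪·,·⟫`), if `μ : ℝ → 𝔤*` solves
`μ' = ad*_{δh(μ)} μ + θ·ad*_{♯(ad*_{δh(μ)} μ)} μ`, then
`(h ∘ μ)'(t) = −θ·γ(a(t), a(t))`; in particular `t ↦ h(μ(t))` is nonincreasing. -/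
theorem lie_poisson_langevin_energy_dissipation
    {G : Type*} [NormedAddCommGroup G] [InnerProductSpace ℝ G] [FiniteDimensional ℝ G]
    (bkt : G →ₗ[ℝ] G →ₗ[ℝ] G)
    (hbkt_self : ∀ x : G, bkt x x = 0)
    (hbkt_jacobi : ∀ x y z : G, bkt x (bkt y z) + bkt y (bkt z x) + bkt z (bkt x y) = 0)
    (coad : G → (G →L[ℝ] ℝ) → (G →L[ℝ] ℝ))
    (hcoad : ∀ (w : G) (ν : G →L[ℝ] ℝ) (x : G), coad w ν x = ν (bkt w x))
    (sharp : (G →L[ℝ] ℝ) → G)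
    (hsharp : ∀ (α : G →L[ℝ] ℝ) (x : G), ⟪sharp α, x⟫ = α x)
    (h : (G →L[ℝ] ℝ) → ℝ) (Dh : (G →L[ℝ] ℝ) → ((G →L[ℝ] ℝ) →L[ℝ] ℝ))
    (δh : (G →L[ℝ] ℝ) → G)
    (hdiff : ∀ ν, HasFDerivAt h (Dh ν) ν)
    (hgrad : ∀ (ν α : G →L[ℝ] ℝ), Dh ν α = α (δh ν))
    (θ : ℝ) (hθ : 0 ≤ θ)
    (μ : ℝ → (G →L[ℝ] ℝ)) (u : ℝ → G) (a : ℝ → G)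
    (hu : ∀ t, u t = δh (μ t))
    (ha : ∀ t, a t = sharp (coad (u t) (μ t)))
    (hμ : ∀ t, HasDerivAt μ (coad (u t) (μ t) + θ • coad (a t) (μ t)) t) :
    (∀ t, HasDerivAt (fun s => h (μ s)) (-θ * ⟪a t, a t⟫) t) ∧
      Antitone (fun t => h (μ t)) := by
  have hskew : ∀ x y : G, bkt x y = -bkt y x := by
    intro x y
    have h1 := hbkt_self (x + y)
    simp only [map_add, LinearMap.add_apply, hbkt_self, zero_add, add_zero] at h1
    first
      | exact eq_neg_of_add_eq_zero_left h1
      | exact eq_neg_of_add_eq_zero_right h1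
  have key : ∀ t, HasDerivAt (fun s => h (μ s)) (-θ * ⟪a t, a t⟫) t := by
    intro t
    have h1 := (hdiff (μ t)).comp_hasDerivAt t (hμ t)
    have h2 : Dh (μ t) (coad (u t) (μ t) + θ • coad (a t) (μ t)) = -θ * ⟪a t, a t⟫ := by
      have h3 : ⟪a t, a t⟫ = μ t (bkt (u t) (a t)) := by
        rw [← hcoad, ← hsharp, ← ha]
      rw [hgrad, ← hu, h3, ContinuousLinearMap.add_apply, ContinuousLinearMap.smul_apply,
        hcoad, hcoad, hbkt_self, hskew (a t) (u t), map_zero, map_neg, smul_eq_mul]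
      ring
    rw [h2] at h1
    exact h1
  refine ⟨key, antitone_of_deriv_nonpos (fun t => (key t).differentiableAt) fun t => ?_⟩
  rw [(key t).deriv]
  have : (0 : ℝ) ≤ ⟪a t, a t⟫ := real_inner_self_nonneg
  nlinarith [mul_nonneg hθ this]
end

section
/- Preservation of the heavy-top Casimirs by the dissipative heavy top dynamics (Appendix C.4): Let A : ℝ³ → ℝ³ be a linear map, let c, θ ∈ ℝ, let χ ∈ ℝ³ be a fixed vector, and let (Π, Γ) : ℝ → ℝ³ × ℝ³ be a differentiable curve satisfying, for all t, with D(t) := Π(t) × (A Π(t)) + c·Γ(t) × χ: Π'(t) = D(t) − θ·( Π(t) × D(t) + Γ(t) × (Γ(t) × (A Π(t))) ) and Γ'(t) = Γ(t) × (A Π(t)) − θ·Γ(t) × D(t). Then ‖Γ(t)‖ = ‖Γ(0)‖ and ⟨Π(t), Γ(t)⟩ = ⟨Π(0), Γ(0)⟩ for all t ∈ ℝ; i.e. the coadjoint orbit {(Π, Γ) : ‖Γ‖² = ‖Γ₀‖², Π·Γ = Π₀·Γ₀} of 𝔰𝔬(3)* ⋉ (ℝ³)* is preserved. -/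
open scoped RealInnerProductSpace

/-- The cross product on `ℝ³ = EuclideanSpace ℝ (Fin 3)`. -/
noncomputable def cross3 (x y : EuclideanSpace ℝ (Fin 3)) : EuclideanSpace ℝ (Fin 3) :=
  (EuclideanSpace.equiv (Fin 3) ℝ).symm
    (crossProduct ((EuclideanSpace.equiv (Fin 3) ℝ) x) ((EuclideanSpace.equiv (Fin 3) ℝ) y))

theorem inner_cross3_fst (x y : EuclideanSpace ℝ (Fin 3)) : ⟪x, cross3 x y⟫ = 0 := by
  simp [cross3, PiLp.inner_apply, Fin.sum_univ_three, crossProduct]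
  ring

theorem inner_cross3_perm (x y z : EuclideanSpace ℝ (Fin 3)) :
    ⟪x, cross3 y z⟫ + ⟪cross3 x z, y⟫ = 0 := by
  simp [cross3, PiLp.inner_apply, Fin.sum_univ_three, crossProduct]
  ring

/-- **Preservation of the heavy-top Casimirs by the dissipative heavy top dynamics**
(Appendix C.4): along any solution of
`Π' = D − θ·(Π × D + Γ × (Γ × (A Π)))`, `Γ' = Γ × (A Π) − θ·Γ × D`, with
`D = Π × (A Π) + c·Γ × χ`, both `‖Γ‖` and `⟨Π, Γ⟩` are conserved, i.e. the coadjoint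
orbit `{(Π, Γ) : ‖Γ‖² = ‖Γ₀‖², Π·Γ = Π₀·Γ₀}` of `𝔰𝔬(3)* ⋉ (ℝ³)*` is preserved. -/
theorem dissipative_heavy_top_preserves_casimirs
    (A : EuclideanSpace ℝ (Fin 3) →ₗ[ℝ] EuclideanSpace ℝ (Fin 3))
    (c θ : ℝ) (χ : EuclideanSpace ℝ (Fin 3))
    (Pv Gm D : ℝ → EuclideanSpace ℝ (Fin 3))
    (hD : ∀ t, D t = cross3 (Pv t) (A (Pv t)) + c • cross3 (Gm t) χ)
    (hPv : ∀ t, HasDerivAt Pv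
      (D t - θ • (cross3 (Pv t) (D t) + cross3 (Gm t) (cross3 (Gm t) (A (Pv t))))) t)
    (hGm : ∀ t, HasDerivAt Gm
      (cross3 (Gm t) (A (Pv t)) - θ • cross3 (Gm t) (D t)) t) :
    ∀ t : ℝ, ‖Gm t‖ = ‖Gm 0‖ ∧ ⟪Pv t, Gm t⟫ = ⟪Pv 0, Gm 0⟫ := by
  have hconst : ∀ f : ℝ → ℝ, (∀ t, HasDerivAt f 0 t) → ∀ t, f t = f 0 := fun f hf t =>
    is_const_of_deriv_eq_zero (fun s => (hf s).differentiableAt) (fun s => (hf s).deriv) t 0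
  intro t
  constructor
  · have h := hconst (fun t => ⟪Gm t, Gm t⟫) (fun s => by
      have h := (hGm s).inner ℝ (hGm s)
      refine HasDerivAt.congr_deriv h ?_
      rw [real_inner_comm (Gm s) (cross3 (Gm s) (A (Pv s)) - θ • cross3 (Gm s) (D s))]
      simp [inner_sub_right, inner_smul_right, inner_cross3_fst]) t
    simp only [real_inner_self_eq_norm_sq] at h
    exact (sq_eq_sq₀ (norm_nonneg _) (norm_nonneg _)).1 h
  · exact hconst (fun t => ⟪Pv t, Gm t⟫) (fun s => by
      have h := (hPv s).inner ℝ (hGm s)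
      refine HasDerivAt.congr_deriv h ?_
      have h1 := inner_cross3_perm (Pv s) (Gm s) (A (Pv s))
      have h2 := inner_cross3_perm (Pv s) (Gm s) (D s)
      have h3 : ⟪cross3 (Gm s) χ, Gm s⟫ = 0 := by
        rw [real_inner_comm]; exact inner_cross3_fst _ _
      have h4 : ⟪cross3 (Gm s) (cross3 (Gm s) (A (Pv s))), Gm s⟫ = 0 := by
        rw [real_inner_comm]; exact inner_cross3_fst _ _
      have h5 : ⟪D s, Gm s⟫ = ⟪cross3 (Pv s) (A (Pv s)), Gm s⟫ := by
        rw [hD s, inner_add_left, real_inner_smul_left, h3]; ring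
      rw [inner_sub_right, inner_sub_left, real_inner_smul_left, real_inner_smul_right,
        inner_add_left, h4, h5]
      linear_combination h1 - θ * h2) t
end
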